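/- Let σ : ℝ → ℝ be L_lip-Lipschitz and let W₁, W₂ ∈ ℝ^{d×d} with ‖W₁‖_F ≤ B and ‖W₂‖_F ≤ B. Define ffn(X) = σ(X W₁) W₂ with σ applied entrywise, and let LN act row-wise on matrices with LN(x) = x if ‖x‖₂ ≤ 1 and LN(x) = x/‖x‖₂ otherwise. Then for any Y, Ỹ ∈ ℝ^{N×d}, ‖ffn(LN(Ỹ)) − ffn(LN(Y))‖_{2,∞} ≤ L_lip · B² · min{2, ‖Ỹ − Y‖_{2,∞}}. -/

import Mathlib

open scoped BigOperators
open Matrix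

/-- The Euclidean (ℓ²) norm on `ℝ^d`. -/
noncomputable def l2norm {d : ℕ} (x : Fin d → ℝ) : ℝ := Real.sqrt (∑ i, x i ^ 2)

/-- The ℓ_{2,∞} norm of a matrix: the maximum ℓ² norm of its rows. -/
noncomputable def norm2inf {N d : ℕ} (X : Matrix (Fin N) (Fin d) ℝ) : ℝ :=
  ⨆ i, l2norm (X i)

/-- The Frobenius norm of a matrix. -/
noncomputable def frobNorm {m n : ℕ} (A : Matrix (Fin m) (Fin n) ℝ) : ℝ :=
  Real.sqrt (∑ i, ∑ j, A i j ^ 2)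

/-- The normalization map: `LN x = x` if `‖x‖₂ ≤ 1` and `LN x = x / ‖x‖₂` otherwise. -/
noncomputable def LN {d : ℕ} (x : Fin d → ℝ) : Fin d → ℝ :=
  if l2norm x ≤ 1 then x else (l2norm x)⁻¹ • x

/-- Row-wise application of `LN` to a matrix. -/
noncomputable def matLN {N d : ℕ} (X : Matrix (Fin N) (Fin d) ℝ) :
    Matrix (Fin N) (Fin d) ℝ :=
  Matrix.of fun i => LN (X i)

/-- The feed-forward module `ffn(X) = σ(X W₁) W₂`, with `σ` applied entrywise. -/
noncomputable def ffn {N d : ℕ} (σ : ℝ → ℝ) (X : Matrix (Fin N) (Fin d) ℝ)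
    (W₁ W₂ : Matrix (Fin d) (Fin d) ℝ) : Matrix (Fin N) (Fin d) ℝ :=
  (X * W₁).map σ * W₂

/-- Radial projection onto the unit ball: the variational inequality. -/
theorem inner_sub_radial_nonpos {E : Type*} [NormedAddCommGroup E] [InnerProductSpace ℝ E]
    {x u v : E} (hu : u = if ‖x‖ ≤ 1 then x else ‖x‖⁻¹ • x) (hv : ‖v‖ ≤ 1) :
    inner ℝ (x - u) (v - u) ≤ 0 := by
  split_ifs at hu with h
  · simp [hu]
  · have hx : 1 < ‖x‖ := not_le.mp h
    have hx0 : ‖x‖ ≠ 0 := by positivity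
    have hxu : x = ‖x‖ • u := by rw [hu, smul_inv_smul₀ hx0]
    have hnu : ‖u‖ = 1 := by
      rw [hu, norm_smul, norm_inv, norm_norm, inv_mul_cancel₀ hx0]
    have hsub : x - u = (‖x‖ - 1) • u := by rw [sub_smul, one_smul, ← hxu]
    have huv : inner ℝ u v ≤ 1 :=
      (real_inner_le_norm u v).trans (by rw [hnu, one_mul]; exact hv)
    rw [hsub, real_inner_smul_left, inner_sub_right, real_inner_self_eq_norm_sq, hnu]
    nlinarith

theorem l2norm_eq_norm {d : ℕ} (x : Fin d → ℝ) : l2norm x = ‖WithLp.toLp 2 x‖ := by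
  simp [l2norm, EuclideanSpace.norm_eq]

theorem l2norm_nonneg {d : ℕ} (x : Fin d → ℝ) : 0 ≤ l2norm x := Real.sqrt_nonneg _

theorem toLp_LN {d : ℕ} (x : Fin d → ℝ) :
    WithLp.toLp 2 (LN x) = if ‖WithLp.toLp 2 x‖ ≤ 1 then WithLp.toLp 2 x
      else ‖WithLp.toLp 2 x‖⁻¹ • WithLp.toLp 2 x := by
  rw [← l2norm_eq_norm, LN]
  split_ifs <;> simp

theorem l2norm_LN_le_one {d : ℕ} (x : Fin d → ℝ) : l2norm (LN x) ≤ 1 := by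
  rw [l2norm_eq_norm, toLp_LN]
  split_ifs with h
  · exact h
  · rw [norm_smul, norm_inv, norm_norm]
    exact inv_mul_le_one

theorem l2norm_LN_sub_le_two {d : ℕ} (x y : Fin d → ℝ) : l2norm (LN x - LN y) ≤ 2 := by
  have hx := l2norm_LN_le_one x
  have hy := l2norm_LN_le_one y
  rw [l2norm_eq_norm] at *
  rw [WithLp.toLp_sub]
  linarith [norm_sub_le (WithLp.toLp 2 (LN x)) (WithLp.toLp 2 (LN y))]

theorem l2norm_LN_sub_le {d : ℕ} (x y : Fin d → ℝ) : l2norm (LN x - LN y) ≤ l2norm (x - y) := by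
  have hx := l2norm_LN_le_one x
  have hy := l2norm_LN_le_one y
  rw [l2norm_eq_norm] at *
  rw [l2norm_eq_norm, WithLp.toLp_sub, WithLp.toLp_sub]
  have h₁ := inner_sub_radial_nonpos (toLp_LN x) hy
  have h₂ := inner_sub_radial_nonpos (toLp_LN y) hx
  generalize WithLp.toLp 2 (LN x) = u at *
  generalize WithLp.toLp 2 (LN y) = v at *
  generalize WithLp.toLp 2 x = a at *
  generalize WithLp.toLp 2 y = b at *
  have h : ‖u - v‖ * ‖u - v‖ ≤ ‖a - b‖ * ‖u - v‖ := by
    refine le_trans ?_ (real_inner_le_norm (a - b) (u - v))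
    rw [← real_inner_self_eq_norm_mul_norm]
    simp only [inner_sub_left, inner_sub_right] at *
    linarith
  rcases (norm_nonneg (u - v)).eq_or_lt with h0 | h0
  · rw [← h0]; exact norm_nonneg _
  · exact le_of_mul_le_mul_right h h0

theorem l2norm_vecMul_le {m n : ℕ} (v : Fin m → ℝ) (W : Matrix (Fin m) (Fin n) ℝ) :
    l2norm (v ᵥ* W) ≤ l2norm v * frobNorm W := by
  rw [l2norm, l2norm, frobNorm, ← Real.sqrt_mul (Finset.sum_nonneg fun _ _ => sq_nonneg _)]
  apply Real.sqrt_le_sqrt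
  rw [Finset.sum_comm, Finset.mul_sum]
  exact Finset.sum_le_sum fun j _ => Finset.sum_mul_sq_le_sq_mul_sq Finset.univ v fun i => W i j

theorem l2norm_comp_sub_le {d : ℕ} {L : ℝ} (hL : 0 ≤ L) {σ : ℝ → ℝ}
    (hσ : ∀ x y : ℝ, |σ x - σ y| ≤ L * |x - y|) (x y : Fin d → ℝ) :
    l2norm (σ ∘ x - σ ∘ y) ≤ L * l2norm (x - y) := by
  rw [l2norm, l2norm, ← Real.sqrt_sq hL, ← Real.sqrt_mul (sq_nonneg L), Finset.mul_sum]
  refine Real.sqrt_le_sqrt (Finset.sum_le_sum fun i _ => ?_)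
  rw [← mul_pow, sq_le_sq, abs_mul, abs_of_nonneg hL]
  exact hσ (x i) (y i)

theorem ffn_sub_apply {N d : ℕ} (σ : ℝ → ℝ) (X X' : Matrix (Fin N) (Fin d) ℝ)
    (W₁ W₂ : Matrix (Fin d) (Fin d) ℝ) (i : Fin N) :
    (ffn σ X W₁ W₂ - ffn σ X' W₁ W₂) i =
      (σ ∘ (X i ᵥ* W₁) - σ ∘ (X' i ᵥ* W₁)) ᵥ* W₂ := by
  rw [Matrix.sub_vecMul]
  rfl

theorem l2norm_row_le_norm2inf {N d : ℕ} (X : Matrix (Fin N) (Fin d) ℝ) (i : Fin N) :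
    l2norm (X i) ≤ norm2inf X :=
  le_ciSup (f := fun i => l2norm (X i)) (Set.finite_range _).bddAbove i

/-- `‖ffn(LN(Ỹ)) − ffn(LN(Y))‖_{2,∞} ≤ L_lip B² min{2, ‖Ỹ − Y‖_{2,∞}}`. -/
theorem ffn_LN_error {N d : ℕ} (L_lip B : ℝ)
    (σ : ℝ → ℝ) (hσ : ∀ x y : ℝ, |σ x - σ y| ≤ L_lip * |x - y|)
    (W₁ W₂ : Matrix (Fin d) (Fin d) ℝ)
    (hW₁ : frobNorm W₁ ≤ B) (hW₂ : frobNorm W₂ ≤ B)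
    (Y Y' : Matrix (Fin N) (Fin d) ℝ) :
    norm2inf (ffn σ (matLN Y') W₁ W₂ - ffn σ (matLN Y) W₁ W₂) ≤
      L_lip * B ^ 2 * min 2 (norm2inf (Y' - Y)) := by
  have hL : 0 ≤ L_lip := by simpa using (abs_nonneg _).trans (hσ 1 0)
  have hB : 0 ≤ B := (Real.sqrt_nonneg _).trans hW₁
  have hmin : 0 ≤ min 2 (norm2inf (Y' - Y)) :=
    le_min zero_le_two (Real.iSup_nonneg fun _ => l2norm_nonneg _)
  refine Real.iSup_le (fun i => ?_) (by positivity)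
  have hLN : l2norm (LN (Y' i) - LN (Y i)) ≤ min 2 (norm2inf (Y' - Y)) :=
    le_min (l2norm_LN_sub_le_two _ _)
      ((l2norm_LN_sub_le _ _).trans (l2norm_row_le_norm2inf (Y' - Y) i))
  rw [ffn_sub_apply]
  change l2norm ((σ ∘ (LN (Y' i) ᵥ* W₁) - σ ∘ (LN (Y i) ᵥ* W₁)) ᵥ* W₂) ≤ _
  calc _ ≤ l2norm (σ ∘ (LN (Y' i) ᵥ* W₁) - σ ∘ (LN (Y i) ᵥ* W₁)) * frobNorm W₂ :=
        l2norm_vecMul_le _ _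
    _ ≤ L_lip * l2norm ((LN (Y' i) - LN (Y i)) ᵥ* W₁) * B := by
        rw [Matrix.sub_vecMul]
        exact mul_le_mul (l2norm_comp_sub_le hL hσ _ _) hW₂ (Real.sqrt_nonneg _)
          (mul_nonneg hL (l2norm_nonneg _))
    _ ≤ L_lip * (min 2 (norm2inf (Y' - Y)) * B) * B := by
        gcongr
        exact (l2norm_vecMul_le _ _).trans (mul_le_mul hLN hW₁ (Real.sqrt_nonneg _) hmin)
    _ = L_lip * B ^ 2 * min 2 (norm2inf (Y' - Y)) := by ring
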